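/- arXiv:1305.0924 — 3 statements merged into one kernel-verified Lean document; each statement's English description precedes it below -/
import Mathlib

section
/- Let q > 1/2. The Cauchy transform of the Student t-distribution t_q is complex-differentiable on the upper half-plane ℂ⁺ and its derivative satisfies G̃'_{t_q}(z) = (2q−1)·(1 − z·G̃_{t_{q+1}}(z)) for every z ∈ ℂ⁺. -/
open MeasureTheory Complex Set

/-- The Cauchy transform `∫ 1/(z-x) dμ(x)` of a measure on ℝ. -/
noncomputable def cauchyT (μ : Measure ℝ) (z : ℂ) : ℂ := ∫ x, (z - (x : ℂ))⁻¹ ∂μ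

/-- The Euler beta function `B(p,q) = ∫₀¹ x^(p-1) (1-x)^(q-1) dx`. -/
noncomputable def betaFun (p q : ℝ) : ℝ := ∫ x in Ioo (0:ℝ) 1, x ^ (p - 1) * (1 - x) ^ (q - 1)

/-- The Student t-distribution `t_q` on ℝ, with density `(1+x²)^(-q)/B(1/2, q-1/2)`. -/
noncomputable def tMeasure (q : ℝ) : Measure ℝ :=
  volume.withDensity fun x =>
    ENNReal.ofReal ((1 + x ^ 2) ^ (-q) / betaFun (1/2) (q - 1/2))

open Filter Topology

lemma one_add_sq_rpow_pos (q x : ℝ) : 0 < (1 + x ^ 2) ^ (-q) :=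
  Real.rpow_pos_of_pos (by positivity) _

lemma one_add_sq_rpow_succ (q x : ℝ) :
    (1 + x ^ 2) * (1 + x ^ 2) ^ (-(q + 1)) = (1 + x ^ 2) ^ (-q) := by
  have h : 0 < 1 + x ^ 2 := by positivity
  nth_rewrite 1 [← Real.rpow_one (1 + x ^ 2)]
  rw [← Real.rpow_add h]
  ring_nf

lemma continuous_one_add_sq_rpow (q : ℝ) : Continuous fun x : ℝ => (1 + x ^ 2) ^ (-q) :=
  Continuous.rpow_const (by fun_prop) fun x => Or.inl (by positivity)

lemma integrable_one_add_sq_rpow {q : ℝ} (hq : 1 / 2 < q) :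
    Integrable fun x : ℝ => (1 + x ^ 2) ^ (-q) := by
  have h := integrable_rpow_neg_one_add_norm_sq (E := ℝ) (μ := volume) (r := 2 * q)
    (by simp; linarith)
  refine h.congr (Eventually.of_forall fun x => ?_)
  simp only [Real.norm_eq_abs, sq_abs]
  congr 1
  ring

lemma hasDerivAt_one_add_sq_rpow (q x : ℝ) :
    HasDerivAt (fun x : ℝ => (1 + x ^ 2) ^ (-q)) (-(2 * q) * x * (1 + x ^ 2) ^ (-(q + 1))) x := by
  have h : HasDerivAt (fun x : ℝ => 1 + x ^ 2) (2 * x) x := by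
    simpa using (hasDerivAt_pow 2 x).const_add 1
  convert h.rpow_const (p := -q) (Or.inl (by positivity)) using 1
  ring_nf

lemma integral_one_add_sq_rpow_pos {q : ℝ} (hq : 1 / 2 < q) :
    0 < ∫ x : ℝ, (1 + x ^ 2) ^ (-q) := by
  rw [integral_pos_iff_support_of_nonneg (fun x => (one_add_sq_rpow_pos q x).le)
    (integrable_one_add_sq_rpow hq)]
  have : (Function.support fun x : ℝ => (1 + x ^ 2) ^ (-q)) = univ := by
    ext x
    simpa using (one_add_sq_rpow_pos q x).ne'
  simp [this]

lemma tendsto_mul_one_add_sq_rpow {q : ℝ} (hq : 1 / 2 < q) {l : Filter ℝ}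
    (hl : Tendsto (fun x : ℝ => x ^ 2) l atTop) :
    Tendsto (fun x : ℝ => x * (1 + x ^ 2) ^ (-q)) l (𝓝 0) := by
  have h := (tendsto_rpow_neg_atTop (y := q - 1 / 2) (by linarith)).comp
    (tendsto_atTop_add_const_left l 1 hl)
  refine squeeze_zero_norm (fun x => ?_) h
  have hx : 0 < 1 + x ^ 2 := by positivity
  have hs : (1 + x ^ 2) ^ (-(q - 1 / 2)) = √(1 + x ^ 2) * (1 + x ^ 2) ^ (-q) := by
    rw [Real.sqrt_eq_rpow, ← Real.rpow_add hx]
    ring_nf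
  simp only [Function.comp, norm_mul, Real.norm_eq_abs, abs_of_pos (one_add_sq_rpow_pos q x), hs]
  gcongr
  exact Real.abs_le_sqrt (by linarith)

lemma integral_one_add_sq_rpow_succ {q : ℝ} (hq : 1 / 2 < q) :
    2 * q * ∫ x : ℝ, (1 + x ^ 2) ^ (-(q + 1)) = (2 * q - 1) * ∫ x : ℝ, (1 + x ^ 2) ^ (-q) := by
  have h0 := (integrable_one_add_sq_rpow hq).const_mul (2 * q - 1)
  have h1 := (integrable_one_add_sq_rpow (q := q + 1) (by linarith)).const_mul (2 * q)
  have hd (x : ℝ) : HasDerivAt (fun x : ℝ => x * (1 + x ^ 2) ^ (-q))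
      (2 * q * (1 + x ^ 2) ^ (-(q + 1)) - (2 * q - 1) * (1 + x ^ 2) ^ (-q)) x := by
    refine ((hasDerivAt_id x).mul (hasDerivAt_one_add_sq_rpow q x)).congr_deriv ?_
    rw [← one_add_sq_rpow_succ q x, id]
    ring
  have key := integral_of_hasDerivAt_of_tendsto hd (h1.sub h0)
    (tendsto_mul_one_add_sq_rpow hq (by
      simpa [Function.comp_def] using
        (tendsto_pow_atTop (two_ne_zero)).comp (tendsto_abs_atBot_atTop (G := ℝ))))
    (tendsto_mul_one_add_sq_rpow hq (tendsto_pow_atTop two_ne_zero))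
  rw [integral_sub h1 h0, integral_const_mul, integral_const_mul] at key
  linarith

lemma image_sq_div_one_add_sq :
    (fun x : ℝ => x ^ 2 / (1 + x ^ 2)) '' Ioi 0 = Ioo 0 1 := by
  ext y
  constructor
  · rintro ⟨x, hx, rfl⟩
    have hx : 0 < x := hx
    exact ⟨by positivity, by rw [div_lt_one (by positivity)]; linarith⟩
  · rintro ⟨h0, h1⟩
    have h2 : 0 < 1 - y := by linarith
    refine ⟨√(y / (1 - y)), Real.sqrt_pos.2 (by positivity), ?_⟩
    simp only
    rw [Real.sq_sqrt (by positivity)]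
    field_simp
    ring

lemma betaFun_eq_integral (q : ℝ) :
    betaFun (1 / 2) (q - 1 / 2) = ∫ x : ℝ, (1 + x ^ 2) ^ (-q) := by
  have h := integral_comp_abs (f := fun x : ℝ => (1 + x ^ 2) ^ (-q))
  simp only [sq_abs] at h
  rw [h, betaFun, ← image_sq_div_one_add_sq,
    integral_image_eq_integral_abs_deriv_smul (f' := fun x => 2 * x / (1 + x ^ 2) ^ 2)
      measurableSet_Ioi, ← integral_const_mul]
  · refine setIntegral_congr_fun measurableSet_Ioi fun x hx => ?_
    have hx : 0 < x := hx
    have hp : 0 < 1 + x ^ 2 := by positivity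
    have h1 : 1 - x ^ 2 / (1 + x ^ 2) = (1 + x ^ 2)⁻¹ := by field_simp; ring
    have h2 : (x ^ 2 / (1 + x ^ 2)) ^ ((1 : ℝ) / 2 - 1) = x⁻¹ * (1 + x ^ 2) ^ ((1 : ℝ) / 2) := by
      have hs : (x ^ 2) ^ ((1 : ℝ) / 2 - 1) = x⁻¹ := by
        rw [← Real.rpow_natCast x 2, ← Real.rpow_mul hx.le, ← Real.rpow_neg_one]
        norm_num
      rw [Real.div_rpow (by positivity) hp.le, hs, div_eq_mul_inv, ← Real.rpow_neg hp.le]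
      norm_num
    have h3 : ((1 + x ^ 2)⁻¹) ^ (q - 1 / 2 - 1) =
        (1 + x ^ 2) ^ (-q) * (1 + x ^ 2) ^ (-(1 : ℝ) / 2) * (1 + x ^ 2) ^ (2 : ℕ) := by
      rw [Real.inv_rpow hp.le, ← Real.rpow_neg hp.le, ← Real.rpow_natCast (1 + x ^ 2) 2, ← Real.rpow_add hp,
        ← Real.rpow_add hp]
      congr 1
      push_cast
      ring
    have h4 : (1 + x ^ 2) ^ ((1 : ℝ) / 2) * (1 + x ^ 2) ^ (-(1 : ℝ) / 2) = 1 := by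
      rw [← Real.rpow_add hp]
      norm_num
    simp only [smul_eq_mul]
    rw [abs_of_pos (by positivity), h1, h2, h3]
    calc _ = 2 * (1 + x ^ 2) ^ (-q) *
          ((1 + x ^ 2) ^ ((1 : ℝ) / 2) * (1 + x ^ 2) ^ (-(1 : ℝ) / 2)) := by
          field_simp
      _ = _ := by rw [h4, mul_one]
  · intro x _
    have h : HasDerivAt (fun x : ℝ => 1 + x ^ 2) (2 * x) x := by
      simpa using (hasDerivAt_pow 2 x).const_add 1
    have h' : HasDerivAt (fun x : ℝ => x ^ 2) (2 * x) x := by simpa using hasDerivAt_pow 2 x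
    refine ((h'.div h (by positivity)).congr_deriv ?_).hasDerivWithinAt
    ring
  · intro x hx y hy hxy
    have hx : 0 < x := hx
    have hy : 0 < y := hy
    simp only at hxy
    rw [div_eq_div_iff (by positivity) (by positivity)] at hxy
    have : x ^ 2 = y ^ 2 := by linarith
    exact (sq_eq_sq₀ hx.le hy.le).1 this

lemma cauchyT_tMeasure {q : ℝ} (hq : 1 / 2 < q) (z : ℂ) :
    cauchyT (tMeasure q) z = ((∫ x : ℝ, (1 + x ^ 2) ^ (-q) : ℝ) : ℂ)⁻¹ *
      ∫ x : ℝ, (((1 + x ^ 2) ^ (-q) : ℝ) : ℂ) * (z - x)⁻¹ := by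
  rw [cauchyT, tMeasure, integral_withDensity_eq_integral_toReal_smul, ← integral_const_mul]
  · refine integral_congr_ae (Eventually.of_forall fun x => ?_)
    simp only [betaFun_eq_integral]
    rw [ENNReal.toReal_ofReal (div_nonneg (one_add_sq_rpow_pos q x).le
      (integral_one_add_sq_rpow_pos hq).le), Complex.real_smul]
    push_cast
    ring
  · exact ((continuous_one_add_sq_rpow q).measurable.div_const _).ennreal_ofReal
  · exact Eventually.of_forall fun x => ENNReal.ofReal_lt_top

lemma sub_ofReal_ne_zero {z : ℂ} (hz : 0 < z.im) (x : ℝ) : z - x ≠ 0 := by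
  intro h
  have := congrArg Complex.im h
  simp at this
  linarith

lemma norm_inv_sub_ofReal_le {z : ℂ} {c : ℝ} (hc : 0 < c) (hz : c ≤ z.im) (x : ℝ) :
    ‖(z - x)⁻¹‖ ≤ c⁻¹ := by
  rw [norm_inv]
  refine inv_anti₀ hc ?_
  calc c ≤ |(z - x).im| := by simpa using hz.trans (le_abs_self _)
    _ ≤ _ := Complex.abs_im_le_norm _

lemma continuous_inv_sub_ofReal {z : ℂ} (hz : 0 < z.im) :
    Continuous fun x : ℝ => (z - x)⁻¹ :=
  Continuous.inv₀ (by fun_prop) (sub_ofReal_ne_zero hz)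

lemma integrable_one_add_sq_rpow_mul_inv {q : ℝ} (hq : 1 / 2 < q) {z : ℂ} (hz : 0 < z.im) :
    Integrable fun x : ℝ => (((1 + x ^ 2) ^ (-q) : ℝ) : ℂ) * (z - x)⁻¹ :=
  (integrable_one_add_sq_rpow hq).ofReal.mul_bdd (c := z.im⁻¹)
    (continuous_inv_sub_ofReal hz).aestronglyMeasurable
    (Eventually.of_forall (norm_inv_sub_ofReal_le hz le_rfl))

lemma hasDerivAt_integral_one_add_sq_rpow_mul_inv {q : ℝ} (hq : 1 / 2 < q) {z : ℂ}
    (hz : 0 < z.im) :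
    Integrable (fun x : ℝ => (((1 + x ^ 2) ^ (-q) : ℝ) : ℂ) * -((z - x)⁻¹ ^ 2)) ∧
    HasDerivAt (fun w : ℂ => ∫ x : ℝ, (((1 + x ^ 2) ^ (-q) : ℝ) : ℂ) * (w - x)⁻¹)
      (∫ x : ℝ, (((1 + x ^ 2) ^ (-q) : ℝ) : ℂ) * -((z - x)⁻¹ ^ 2)) z := by
  have hs : {w : ℂ | z.im / 2 < w.im} ∈ 𝓝 z :=
    (isOpen_lt continuous_const Complex.continuous_im).mem_nhds (half_lt_self hz)
  have hf : Continuous fun x : ℝ => (((1 + x ^ 2) ^ (-q) : ℝ) : ℂ) :=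
    Complex.continuous_ofReal.comp (continuous_one_add_sq_rpow q)
  have hpos {w : ℂ} (hw : w ∈ {w : ℂ | z.im / 2 < w.im}) : 0 < w.im := (half_pos hz).trans hw
  refine hasDerivAt_integral_of_dominated_loc_of_deriv_le
    (F' := fun w (x : ℝ) => (((1 + x ^ 2) ^ (-q) : ℝ) : ℂ) * -((w - x)⁻¹ ^ 2))
    (bound := fun x => (1 + x ^ 2) ^ (-q) * (z.im / 2)⁻¹ ^ 2) hs ?_
    (integrable_one_add_sq_rpow_mul_inv hq hz) ?_ ?_
    ((integrable_one_add_sq_rpow hq).mul_const _) ?_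
  · filter_upwards [hs] with w hw
    exact (hf.mul (continuous_inv_sub_ofReal (hpos hw))).aestronglyMeasurable
  · exact (hf.mul ((continuous_inv_sub_ofReal hz).pow 2).neg).aestronglyMeasurable
  · refine Eventually.of_forall fun x w hw => ?_
    rw [norm_mul, norm_neg, norm_pow, Complex.norm_real, Real.norm_eq_abs,
      abs_of_pos (one_add_sq_rpow_pos q x)]
    gcongr
    exact norm_inv_sub_ofReal_le (half_pos hz) (le_of_lt hw) x
  · refine Eventually.of_forall fun x w hw => ?_
    have h := (((hasDerivAt_id w).sub_const (x : ℂ)).inv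
      (sub_ofReal_ne_zero (hpos hw) x)).const_mul (((1 + x ^ 2) ^ (-q) : ℝ) : ℂ)
    refine h.congr_deriv ?_
    simp [div_eq_mul_inv]

lemma integral_one_add_sq_rpow_mul_neg_inv_sq {q : ℝ} (hq : 1 / 2 < q) {z : ℂ}
    (hz : 0 < z.im) :
    ∫ x : ℝ, (((1 + x ^ 2) ^ (-q) : ℝ) : ℂ) * -((z - x)⁻¹ ^ 2) =
      2 * q * (((∫ x : ℝ, (1 + x ^ 2) ^ (-(q + 1)) : ℝ) : ℂ) -
        z * ∫ x : ℝ, (((1 + x ^ 2) ^ (-(q + 1)) : ℝ) : ℂ) * (z - x)⁻¹) := by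
  have hq' : 1 / 2 < q + 1 := by linarith
  have i0 := (hasDerivAt_integral_one_add_sq_rpow_mul_inv hq hz).1
  have i1 : Integrable fun x : ℝ => (((1 + x ^ 2) ^ (-(q + 1)) : ℝ) : ℂ) :=
    (integrable_one_add_sq_rpow hq').ofReal
  have i2 := (integrable_one_add_sq_rpow_mul_inv hq' hz).const_mul z
  have i3 : Integrable fun x : ℝ => (2 * q : ℂ) * ((((1 + x ^ 2) ^ (-(q + 1)) : ℝ) : ℂ) -
      z * ((((1 + x ^ 2) ^ (-(q + 1)) : ℝ) : ℂ) * (z - x)⁻¹)) := (i1.sub i2).const_mul _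
  have hd (x : ℝ) : HasDerivAt (fun x : ℝ => (((1 + x ^ 2) ^ (-q) : ℝ) : ℂ) * (z - x)⁻¹)
      (2 * q * ((((1 + x ^ 2) ^ (-(q + 1)) : ℝ) : ℂ) -
        z * ((((1 + x ^ 2) ^ (-(q + 1)) : ℝ) : ℂ) * (z - x)⁻¹)) -
        (((1 + x ^ 2) ^ (-q) : ℝ) : ℂ) * -((z - x)⁻¹ ^ 2)) x := by
    have hne := sub_ofReal_ne_zero hz x
    have h := (hasDerivAt_one_add_sq_rpow q x).ofReal_comp.mul
      (((hasDerivAt_id x).ofReal_comp.const_sub z).inv hne)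
    refine h.congr_deriv ?_
    simp only [Pi.inv_apply, id]
    push_cast
    field_simp
    ring
  have key := integral_eq_zero_of_hasDerivAt_of_integrable hd (i3.sub i0)
    (integrable_one_add_sq_rpow_mul_inv hq hz)
  rw [integral_sub i3 i0, integral_const_mul, integral_sub i1 i2, integral_const_mul,
    integral_complex_ofReal] at key
  exact (sub_eq_zero.1 key).symm

theorem stmt_16 (q : ℝ) (hq : 1/2 < q)
    (z : ℂ) (hz : 0 < z.im) :
    HasDerivAt (cauchyT (tMeasure q))
      ((2 * (q : ℂ) - 1) * (1 - z * cauchyT (tMeasure (q + 1)) z)) z := by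
  have hq' : 1 / 2 < q + 1 := by linarith
  have h := (hasDerivAt_integral_one_add_sq_rpow_mul_inv hq hz).2.const_mul
    ((∫ x : ℝ, (1 + x ^ 2) ^ (-q) : ℝ) : ℂ)⁻¹
  rw [integral_one_add_sq_rpow_mul_neg_inv_sq hq hz] at h
  rw [show cauchyT (tMeasure q) = _ from funext (cauchyT_tMeasure hq), cauchyT_tMeasure hq']
  refine h.congr_deriv ?_
  have hI := (integral_one_add_sq_rpow_pos hq).ne'
  have hJ := (integral_one_add_sq_rpow_pos hq').ne'
  have hrec := congrArg (fun t : ℝ => (t : ℂ)) (integral_one_add_sq_rpow_succ hq)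
  generalize (∫ x : ℝ, (1 + x ^ 2) ^ (-q) : ℝ) = I at *
  generalize (∫ x : ℝ, (1 + x ^ 2) ^ (-(q + 1)) : ℝ) = J at *
  have hI : (I : ℂ) ≠ 0 := Complex.ofReal_ne_zero.2 hI
  have hJ : (J : ℂ) ≠ 0 := Complex.ofReal_ne_zero.2 hJ
  push_cast at hrec
  generalize (∫ x : ℝ, (((1 + x ^ 2) ^ (-(q + 1)) : ℝ) : ℂ) * (z - x)⁻¹) = K
  field_simp
  linear_combination (J - z * K) * hrec
end

section
/- Let p > −1/2 and let u_p be the ultraspherical distribution. For every real y ≠ 0, the derivative of its Cauchy transform at the purely imaginary point iy satisfies G̃'_{u_p}(iy) = 1/(1+y²) + ((2p−1)/(1+y²))·∫_{[−1,1]} x²/(x²+y²) du_p(x); in particular, if p ≥ 1/2 then G̃'_{u_p}(iy) is a positive real number. -/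
open MeasureTheory Complex Set

/-- The ultraspherical distribution `u_p` on `[-1,1]`, with density
`(1-x²)^(p-1/2) / (4^p B(p+1/2, p+1/2))`. -/
noncomputable def ultraMeasure (p : ℝ) : Measure ℝ :=
  volume.withDensity fun x =>
    ENNReal.ofReal ((Icc (-1 : ℝ) 1).indicator
      (fun x => (1 - x ^ 2) ^ (p - 1/2) / ((4 : ℝ) ^ p * betaFun (p + 1/2) (p + 1/2))) x)

theorem hasDerivAt_cauchyT (μ : Measure ℝ) [IsFiniteMeasure μ] {z : ℂ} (hz : z.im ≠ 0) :
    Integrable (fun x : ℝ => -((z - (x : ℂ)) ^ 2)⁻¹) μ ∧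
      HasDerivAt (cauchyT μ) (∫ x : ℝ, -((z - (x : ℂ)) ^ 2)⁻¹ ∂μ) z := by
  have hd : 0 < |z.im| / 2 := by positivity
  have hmeas (w : ℂ) : Measurable fun x : ℝ => (w - (x : ℂ)) := by fun_prop
  have him (w : ℂ) (x : ℝ) : |w.im| ≤ ‖w - (x : ℂ)‖ := by
    simpa using Complex.abs_im_le_norm (w - (x : ℂ))
  have hinv {w : ℂ} (hw : |z.im| / 2 < |w.im|) (x : ℝ) :
      ‖(w - (x : ℂ))⁻¹‖ ≤ (|z.im| / 2)⁻¹ := by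
    rw [norm_inv]
    exact inv_anti₀ hd (hw.le.trans (him w x))
  have hz' : |z.im| / 2 < |z.im| := by linarith
  refine hasDerivAt_integral_of_dominated_loc_of_deriv_le (𝕜 := ℂ)
    (s := {w : ℂ | |z.im| / 2 < |w.im|})
    (F := fun (w : ℂ) (x : ℝ) => (w - (x : ℂ))⁻¹)
    (F' := fun (w : ℂ) (x : ℝ) => -((w - (x : ℂ)) ^ 2)⁻¹) (bound := fun _ => ((|z.im| / 2)⁻¹) ^ 2)
    ?_ ?_ ?_ ?_ ?_ ?_ ?_
  · exact (isOpen_lt continuous_const (by fun_prop)).mem_nhds hz'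
  · exact Filter.Eventually.of_forall fun w => (hmeas w).inv.aestronglyMeasurable
  · exact Integrable.of_bound (hmeas z).inv.aestronglyMeasurable _
      (Filter.Eventually.of_forall (hinv hz'))
  · exact ((hmeas z).pow_const 2).inv.neg.aestronglyMeasurable
  · refine Filter.Eventually.of_forall fun x w hw => ?_
    rw [norm_neg, ← inv_pow, norm_pow]
    exact pow_le_pow_left₀ (norm_nonneg _) (hinv hw x) 2
  · exact integrable_const _
  · refine Filter.Eventually.of_forall fun x w hw => ?_
    have hne : w - (x : ℂ) ≠ 0 := norm_pos_iff.1 ((hd.trans hw).trans_le (him w x))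
    simpa [neg_div] using ((hasDerivAt_id w).sub_const (x : ℂ)).fun_inv hne

theorem intervalIntegrable_one_sub_sq_rpow {q : ℝ} (hq : -1 < q) :
    IntervalIntegrable (fun x : ℝ => (1 - x ^ 2) ^ q) volume (-1) 1 := by
  have h01 : IntervalIntegrable (fun x : ℝ => (1 - x ^ 2) ^ q) volume 0 1 := by
    have h1 : IntervalIntegrable (fun x : ℝ => (1 - x) ^ q) volume 0 1 := by
      simpa using ((intervalIntegral.intervalIntegrable_rpow' (a := 0) (b := 1) hq).comp_sub_left
        1).symm
    have h2 : ContinuousOn (fun x : ℝ => (1 + x) ^ q) (uIcc 0 1) := by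
      rw [uIcc_of_le zero_le_one]
      exact ContinuousOn.rpow_const (by fun_prop) fun x hx => Or.inl (by linarith [hx.1])
    refine (h1.mul_continuousOn h2).congr fun x hx => ?_
    rw [uIoc_of_le zero_le_one] at hx
    rw [← Real.mul_rpow (by linarith [hx.2]) (by linarith [hx.1])]
    ring_nf
  have h10 : IntervalIntegrable (fun x : ℝ => (1 - x ^ 2) ^ q) volume (-1) 0 := by
    simpa using (h01.comp_mul_left (c := -1)).symm
  exact h10.trans h01

theorem integral_one_sub_sq_rpow (p : ℝ) :
    ∫ x in (-1 : ℝ)..1, (1 - x ^ 2) ^ (p - 1 / 2) =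
      (4 : ℝ) ^ p * betaFun (p + 1 / 2) (p + 1 / 2) := by
  have h := intervalIntegral.integral_comp_mul_add (a := 0) (b := 1)
    (fun x : ℝ => (1 - x ^ 2) ^ (p - 1 / 2)) (two_ne_zero (α := ℝ)) (-1)
  norm_num at h
  have h' : ∫ t in (0 : ℝ)..1, (1 - (2 * t + -1) ^ 2) ^ (p - 1 / 2) =
      4 ^ (p - 1 / 2) * betaFun (p + 1 / 2) (p + 1 / 2) := by
    rw [betaFun, ← integral_Ioc_eq_integral_Ioo, ← intervalIntegral.integral_of_le zero_le_one,
      ← intervalIntegral.integral_const_mul]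
    refine intervalIntegral.integral_congr fun t ht => ?_
    rw [uIcc_of_le zero_le_one] at ht
    have ht1 : 0 ≤ 1 - t := by linarith [ht.2]
    rw [show p + 1 / 2 - 1 = p - 1 / 2 by ring, ← Real.mul_rpow ht.1 ht1,
      ← Real.mul_rpow (by norm_num) (mul_nonneg ht.1 ht1)]
    ring_nf
  have h4 : (4 : ℝ) ^ (p - 1 / 2) = 4 ^ p / 2 := by
    rw [Real.rpow_sub (by norm_num), ← Real.sqrt_eq_rpow,
      show (4 : ℝ) = 2 ^ 2 by norm_num, Real.sqrt_sq (by norm_num)]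
  norm_num at h' h4
  rw [h', h4] at h
  norm_num
  linarith

theorem ultraMeasure_normalization_pos {p : ℝ} (hp : -(1 / 2) < p) :
    0 < (4 : ℝ) ^ p * betaFun (p + 1 / 2) (p + 1 / 2) := by
  rw [← integral_one_sub_sq_rpow]
  refine intervalIntegral.intervalIntegral_pos_of_pos_on
    (intervalIntegrable_one_sub_sq_rpow (by linarith)) (fun x hx => ?_) (by norm_num)
  exact Real.rpow_pos_of_pos (by nlinarith [hx.1, hx.2]) _

theorem ultraMeasure_density_nonneg {p : ℝ} (hp : -(1 / 2) < p) (x : ℝ) :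
    0 ≤ (Icc (-1 : ℝ) 1).indicator
      (fun x => (1 - x ^ 2) ^ (p - 1 / 2) /
        ((4 : ℝ) ^ p * betaFun (p + 1 / 2) (p + 1 / 2))) x := by
  refine indicator_nonneg (fun x hx => ?_) x
  exact div_nonneg (Real.rpow_nonneg (by nlinarith [hx.1, hx.2]) _)
    (ultraMeasure_normalization_pos hp).le

theorem isProbabilityMeasure_ultraMeasure {p : ℝ} (hp : -(1 / 2) < p) :
    IsProbabilityMeasure (ultraMeasure p) := by
  constructor
  rw [ultraMeasure, withDensity_apply _ MeasurableSet.univ, Measure.restrict_univ,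
    ← ofReal_integral_eq_lintegral_ofReal, integral_indicator measurableSet_Icc,
    integral_Icc_eq_integral_Ioc, ← intervalIntegral.integral_of_le (by norm_num),
    intervalIntegral.integral_div, integral_one_sub_sq_rpow,
    div_self (ultraMeasure_normalization_pos hp).ne', ENNReal.ofReal_one]
  · rw [integrable_indicator_iff measurableSet_Icc]
    exact ((intervalIntegrable_iff_integrableOn_Icc_of_le (by norm_num)).1
      (intervalIntegrable_one_sub_sq_rpow (by linarith))).div_const _
  · exact Filter.Eventually.of_forall (ultraMeasure_density_nonneg hp)

theorem integral_ultraMeasure {p : ℝ} (hp : -(1 / 2) < p) (f : ℝ → ℝ) :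
    ∫ x, f x ∂(ultraMeasure p) =
      (∫ x in (-1 : ℝ)..1, (1 - x ^ 2) ^ (p - 1 / 2) * f x) /
        ((4 : ℝ) ^ p * betaFun (p + 1 / 2) (p + 1 / 2)) := by
  rw [ultraMeasure, integral_withDensity_eq_integral_toReal_smul,
    ← intervalIntegral.integral_div, intervalIntegral.integral_of_le (by norm_num),
    ← integral_Icc_eq_integral_Ioc, ← integral_indicator measurableSet_Icc]
  · refine integral_congr_ae (Filter.Eventually.of_forall fun x => ?_)
    simp only
    rw [ENNReal.toReal_ofReal (ultraMeasure_density_nonneg hp x)]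
    by_cases hx : x ∈ Icc (-1 : ℝ) 1
    · simp only [indicator_of_mem hx, smul_eq_mul]
      ring
    · simp [indicator_of_notMem hx]
  · exact (Measurable.indicator (by fun_prop) measurableSet_Icc).ennreal_ofReal
  · exact Filter.Eventually.of_forall fun x => ENNReal.ofReal_lt_top

theorem integral_ultraMeasure_of_odd {p : ℝ} (hp : -(1 / 2) < p) {f : ℝ → ℝ}
    (hf : ∀ x, f (-x) = -f x) : ∫ x, f x ∂(ultraMeasure p) = 0 := by
  rw [integral_ultraMeasure hp]
  have h := intervalIntegral.integral_comp_neg (a := -1) (b := 1)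
    (fun x : ℝ => (1 - x ^ 2) ^ (p - 1 / 2) * f x)
  simp only [hf, neg_sq, mul_neg, intervalIntegral.integral_neg, neg_neg] at h
  rw [show (∫ x in (-1 : ℝ)..1, (1 - x ^ 2) ^ (p - 1 / 2) * f x) = 0 by linarith, zero_div]

theorem hasDerivAt_one_sub_sq_rpow_mul_div {p y x : ℝ} (hy : y ≠ 0) (hx : x ∈ Ioo (-1 : ℝ) 1) :
    HasDerivAt (fun x : ℝ => (1 - x ^ 2) ^ (p + 1 / 2) * (x / (x ^ 2 + y ^ 2)))
      ((1 + y ^ 2) * ((1 - x ^ 2) ^ (p - 1 / 2) * ((y ^ 2 - x ^ 2) / (x ^ 2 + y ^ 2) ^ 2))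
        - (1 - x ^ 2) ^ (p - 1 / 2)
        - (2 * p - 1) * ((1 - x ^ 2) ^ (p - 1 / 2) * (x ^ 2 / (x ^ 2 + y ^ 2)))) x := by
  have hpos : 0 < 1 - x ^ 2 := by nlinarith [hx.1, hx.2]
  have hden : x ^ 2 + y ^ 2 ≠ 0 := by positivity
  have h1 : HasDerivAt (fun x : ℝ => (1 - x ^ 2)) (-(2 * x)) x := by
    simpa using (hasDerivAt_pow 2 x).const_sub 1
  have h2 : HasDerivAt (fun x : ℝ => x ^ 2 + y ^ 2) (2 * x) x := by
    simpa using (hasDerivAt_pow 2 x).add_const (y ^ 2)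
  have h3 := (h1.rpow_const (p := p + 1 / 2) (Or.inl hpos.ne')).mul
    ((hasDerivAt_id x).div h2 hden)
  refine h3.congr_deriv ?_
  have hr : (1 - x ^ 2) ^ (p + 1 / 2) = (1 - x ^ 2) ^ (p - 1 / 2) * (1 - x ^ 2) := by
    rw [← Real.rpow_add_one hpos.ne']
    ring_nf
  simp only [Pi.div_apply, id]
  rw [hr, show p + 1 / 2 - 1 = p - 1 / 2 by ring]
  generalize (1 - x ^ 2) ^ (p - 1 / 2) = w
  field_simp
  ring

theorem integral_ultraMeasure_poisson_deriv {p : ℝ} (hp : -(1 / 2) < p) {y : ℝ} (hy : y ≠ 0) :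
    ∫ x, (y ^ 2 - x ^ 2) / (x ^ 2 + y ^ 2) ^ 2 ∂(ultraMeasure p) =
      1 / (1 + y ^ 2)
        + ((2 * p - 1) / (1 + y ^ 2)) * ∫ x, x ^ 2 / (x ^ 2 + y ^ 2) ∂(ultraMeasure p) := by
  have hden (x : ℝ) : x ^ 2 + y ^ 2 ≠ 0 := by positivity
  have hw := intervalIntegrable_one_sub_sq_rpow (q := p - 1 / 2) (by linarith)
  have hA := hw.mul_continuousOn (g := fun x => (y ^ 2 - x ^ 2) / (x ^ 2 + y ^ 2) ^ 2)
    (Continuous.continuousOn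
      (Continuous.div (by fun_prop) (by fun_prop) fun x => pow_ne_zero 2 (hden x)))
  have hB := hw.mul_continuousOn (g := fun x => x ^ 2 / (x ^ 2 + y ^ 2))
    (Continuous.continuousOn (Continuous.div (by fun_prop) (by fun_prop) hden))
  have hcont : ContinuousOn (fun x : ℝ => (1 - x ^ 2) ^ (p + 1 / 2) * (x / (x ^ 2 + y ^ 2)))
      (Icc (-1) 1) :=
    (ContinuousOn.rpow_const (by fun_prop) fun x _ => Or.inr (by linarith)).mul
      (Continuous.continuousOn (Continuous.div (by fun_prop) (by fun_prop) hden))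
  have key := intervalIntegral.integral_eq_sub_of_hasDerivAt_of_le (by norm_num) hcont
    (fun x hx => hasDerivAt_one_sub_sq_rpow_mul_div hy hx)
    (((hA.const_mul (1 + y ^ 2)).sub hw).sub (hB.const_mul (2 * p - 1)))
  rw [intervalIntegral.integral_sub ((hA.const_mul _).sub hw) (hB.const_mul _),
    intervalIntegral.integral_sub (hA.const_mul _) hw, intervalIntegral.integral_const_mul,
    intervalIntegral.integral_const_mul, integral_one_sub_sq_rpow] at key
  have h0 : (0 : ℝ) ^ (p + 1 / 2) = 0 := Real.zero_rpow (by linarith)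
  rw [neg_one_sq, one_pow, sub_self, h0, zero_mul, zero_mul, sub_zero] at key
  have hC := ultraMeasure_normalization_pos hp
  rw [integral_ultraMeasure hp, integral_ultraMeasure hp]
  generalize (4 : ℝ) ^ p * betaFun (p + 1 / 2) (p + 1 / 2) = C at *
  generalize (∫ x in (-1 : ℝ)..1,
    (1 - x ^ 2) ^ (p - 1 / 2) * ((y ^ 2 - x ^ 2) / (x ^ 2 + y ^ 2) ^ 2)) = A at *
  generalize (∫ x in (-1 : ℝ)..1, (1 - x ^ 2) ^ (p - 1 / 2) * (x ^ 2 / (x ^ 2 + y ^ 2))) = B at *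
  have hy1 : 1 + y ^ 2 ≠ 0 := by positivity
  field_simp
  linarith

theorem neg_inv_sq_ofReal_mul_I_sub (y x : ℝ) :
    -(((y : ℂ) * I - (x : ℂ)) ^ 2)⁻¹ =
      ⟨(y ^ 2 - x ^ 2) / (x ^ 2 + y ^ 2) ^ 2, -(2 * x * y) / (x ^ 2 + y ^ 2) ^ 2⟩ := by
  have hsq : ((y : ℂ) * I - (x : ℂ)) ^ 2 = ⟨x ^ 2 - y ^ 2, -(2 * x * y)⟩ := by
    apply Complex.ext
    · simp [sq]
    · simp [sq]
      ring
  have hn : Complex.normSq ⟨x ^ 2 - y ^ 2, -(2 * x * y)⟩ = (x ^ 2 + y ^ 2) ^ 2 := by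
    rw [Complex.normSq_mk]
    ring
  rw [hsq]
  apply Complex.ext
  · rw [Complex.neg_re, Complex.inv_re, hn]
    ring
  · rw [Complex.neg_im, Complex.inv_im, hn]
    ring

theorem stmt_18 (p : ℝ) (hp : -(1/2) < p) (y : ℝ) (hy : y ≠ 0) :
    HasDerivAt (cauchyT (ultraMeasure p))
      (((1 / (1 + y ^ 2)
          + ((2 * p - 1) / (1 + y ^ 2)) * ∫ x, x ^ 2 / (x ^ 2 + y ^ 2) ∂(ultraMeasure p) : ℝ)) : ℂ)
      ((y : ℂ) * Complex.I) ∧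
    (1/2 ≤ p →
      0 < 1 / (1 + y ^ 2)
          + ((2 * p - 1) / (1 + y ^ 2)) * ∫ x, x ^ 2 / (x ^ 2 + y ^ 2) ∂(ultraMeasure p)) := by
  have := isProbabilityMeasure_ultraMeasure hp
  constructor
  · obtain ⟨hint, hderiv⟩ :=
      hasDerivAt_cauchyT (ultraMeasure p) (z := (y : ℂ) * Complex.I) (by simpa using hy)
    refine hderiv.congr_deriv ?_
    rw [← integral_ultraMeasure_poisson_deriv hp hy]
    simp only [neg_inv_sq_ofReal_mul_I_sub] at hint ⊢
    apply Complex.ext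
    · exact (integral_re hint).symm
    · rw [Complex.ofReal_im]
      refine (integral_im hint).symm.trans (integral_ultraMeasure_of_odd hp fun x => ?_)
      simp only [RCLike.im_to_complex]
      ring
  · intro hp2
    have hI : 0 ≤ ∫ x, x ^ 2 / (x ^ 2 + y ^ 2) ∂(ultraMeasure p) :=
      integral_nonneg fun x => by positivity
    have hc : 0 ≤ 2 * p - 1 := by linarith
    positivity
end

section
/- Define H(z) := (1/√(2π))·∫_ℝ e^{−(y−i)²/2}/(z − y + i) dy for complex z with Im z > −1. Then (a) H(z) = G_𝐠(z) for every z in the upper half-plane ℂ⁺, where 𝐠 is the standard Gaussian distribution; and (b) x·H(x) → 1 as x → +∞ and as x → −∞ along the real axis. -/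
open MeasureTheory Complex Set Filter

/-- The shifted-contour integral `H(z) = (1/√(2π)) ∫_ℝ e^{-(y-i)²/2}/(z-y+i) dy`. -/
noncomputable def shiftedGaussTransform (z : ℂ) : ℂ :=
  (1 / (Real.sqrt (2 * Real.pi) : ℂ)) *
    ∫ y : ℝ, Complex.exp (-((y : ℂ) - Complex.I) ^ 2 / 2) / (z - (y : ℂ) + Complex.I)

lemma norm_exp_neg_sq_div_two (w : ℂ) :
    ‖Complex.exp (-w ^ 2 / 2)‖ = Real.exp ((w.im ^ 2 - w.re ^ 2) / 2) := by
  rw [Complex.norm_exp]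
  congr 1
  have : -w ^ 2 / 2 = ((1 / 2 : ℝ) : ℂ) * -(w * w) := by push_cast; ring
  rw [this, Complex.re_ofReal_mul, Complex.neg_re, Complex.mul_re]
  ring

lemma integrable_exp_neg_add_mul_I_sq_div_two (c : ℝ) :
    Integrable fun y : ℝ => Complex.exp (-((y : ℂ) + c * I) ^ 2 / 2) := by
  refine (GaussianFourier.integrable_cexp_neg_mul_sq_add_real_mul_I
    (b := 1 / 2) (by norm_num) c).congr (.of_forall fun y => ?_)
  simp only
  congr 1
  ring

lemma integral_exp_neg_sub_I_sq_div_two :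
    ∫ y : ℝ, Complex.exp (-((y : ℂ) - I) ^ 2 / 2) = (Real.sqrt (2 * Real.pi) : ℂ) := by
  have h := GaussianFourier.integral_cexp_neg_mul_sq_add_real_mul_I
    (b := 1 / 2) (by norm_num) (-1)
  have e : ((Real.pi : ℂ) / (1 / 2)) ^ (1 / 2 : ℂ) = (Real.sqrt (2 * Real.pi) : ℂ) := by
    rw [Real.sqrt_eq_rpow, Complex.ofReal_cpow (by positivity)]
    push_cast
    congr 1
    ring
  rw [← e, ← h]
  congr 1 with y
  congr 1
  push_cast
  ring

/-- On the horizontal line of height `c < z.im`, the Gaussian Cauchy integrand is integrable. -/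
lemma integrable_exp_neg_sq_div_two_div_sub {z : ℂ} {c : ℝ} (hc : c < z.im) :
    Integrable fun y : ℝ => Complex.exp (-((y : ℂ) + c * I) ^ 2 / 2) / (z - (y + c * I)) := by
  have hne : ∀ y : ℝ, z - (y + c * I) ≠ 0 := fun y h => by
    have := congrArg Complex.im h
    simp at this
    linarith
  refine ((integrable_exp_neg_add_mul_I_sq_div_two c).norm.div_const (z.im - c)).mono' ?_
    (.of_forall fun y => ?_)
  · exact (Continuous.div (by fun_prop) (by fun_prop) hne).aestronglyMeasurable
  · rw [norm_div]
    have : z.im - c ≤ ‖z - (y + c * I)‖ := by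
      refine le_trans ?_ ((le_abs_self _).trans (Complex.abs_im_le_norm _))
      simp
    gcongr

/-- The Gaussian Cauchy integrand has the same integral along `ℝ` and along `ℝ - i`. -/
lemma integral_gaussian_div_sub_I_eq {z : ℂ} (hz : 0 < z.im) :
    ∫ y : ℝ, Complex.exp (-((y : ℂ) - I) ^ 2 / 2) / (z - y + I) =
      ∫ y : ℝ, Complex.exp (-(y : ℂ) ^ 2 / 2) / (z - y) := by
  set f : ℂ → ℂ := fun w => Complex.exp (-w ^ 2 / 2) / (z - w) with hf
  have hi₀ : Integrable fun y : ℝ => f y := by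
    simpa [hf] using integrable_exp_neg_sq_div_two_div_sub hz
  have hi₁ : Integrable fun y : ℝ => f (y + (-1 : ℝ) * I) :=
    integrable_exp_neg_sq_div_two_div_sub (by linarith)
  have hrect : ∀ T : ℝ,
      (∫ x : ℝ in -T..T, f x) - (∫ x : ℝ in -T..T, f (x + (-1 : ℝ) * I)) +
        I * (∫ y : ℝ in (0 : ℝ)..(-1), f (T + y * I)) -
        I * (∫ y : ℝ in (0 : ℝ)..(-1), f (-T + y * I)) = 0 := by
    intro T
    have := integral_boundary_rect_eq_zero_of_differentiableOn f (-T) (T + (-1 : ℝ) * I) (by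
      intro w hw
      have him : w.im ≤ 0 := by
        have := hw.2
        simp at this
        exact this.2
      have hne : z - w ≠ 0 := fun h => by
        have := congrArg Complex.im h
        simp at this
        linarith
      exact (DifferentiableAt.div (by fun_prop) (by fun_prop) hne).differentiableWithinAt)
    simpa using this
  have hbound : ∀ T y : ℝ, y ∈ Set.uIoc (0 : ℝ) (-1) →
      ‖f (T + y * I)‖ ≤ Real.exp ((1 - T ^ 2) / 2) / z.im := by
    intro T y hy
    have hy : -1 < y ∧ y ≤ 0 := by
      rw [Set.uIoc_of_ge (by norm_num)] at hy
      exact hy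
    have h₁ : z.im ≤ ‖z - (T + y * I)‖ := by
      refine le_trans ?_ ((le_abs_self _).trans (Complex.abs_im_le_norm _))
      simp
      linarith
    have h₂ : (((T : ℂ) + y * I).im ^ 2 - ((T : ℂ) + y * I).re ^ 2) / 2 ≤ (1 - T ^ 2) / 2 := by
      simp
      nlinarith
    rw [hf]
    simp only [norm_div, norm_exp_neg_sq_div_two]
    gcongr
  have hdecay : Tendsto (fun T : ℝ => Real.exp ((1 - T ^ 2) / 2) / z.im) atTop (nhds 0) := by
    rw [← zero_div z.im]
    refine (Real.tendsto_exp_atBot.comp ?_).div_const _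
    refine Tendsto.atBot_div_const (by norm_num) ?_
    exact tendsto_atBot_add_const_left _ 1
      (tendsto_neg_atTop_atBot.comp (tendsto_pow_atTop two_ne_zero))
  have hside : ∀ s : ℝ → ℝ, (∀ T, s T ^ 2 = T ^ 2) →
      Tendsto (fun T => ∫ y : ℝ in (0 : ℝ)..(-1), f (s T + y * I)) atTop (nhds 0) := by
    intro s hs
    refine squeeze_zero_norm (fun T => ?_) hdecay
    have := intervalIntegral.norm_integral_le_of_norm_le_const (hbound (s T))
    simpa [hs T] using this
  have hlim := (((intervalIntegral_tendsto_integral hi₀ tendsto_neg_atTop_atBot tendsto_id).sub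
    (intervalIntegral_tendsto_integral hi₁ tendsto_neg_atTop_atBot tendsto_id)).add
    ((hside id fun _ => rfl).const_mul I)).sub
    ((hside (fun T => -T) fun T => by ring).const_mul I)
  have hzero := tendsto_nhds_unique hlim
    (tendsto_const_nhds.congr fun T => by simpa using (hrect T).symm)
  simp only [mul_zero, add_zero, sub_zero, sub_eq_zero] at hzero
  refine Eq.trans ?_ hzero.symm
  congr 1 with y
  simp only [hf]
  congr 2
  · push_cast
    ring
  · push_cast
    ring

lemma cauchyT_gaussianReal (z : ℂ) :
    cauchyT (ProbabilityTheory.gaussianReal 0 1) z =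
      (1 / (Real.sqrt (2 * Real.pi) : ℂ)) * ∫ y : ℝ, Complex.exp (-(y : ℂ) ^ 2 / 2) / (z - y) := by
  rw [cauchyT, ProbabilityTheory.integral_gaussianReal_eq_integral_smul one_ne_zero,
    ← integral_const_mul]
  congr 1 with y
  simp only [ProbabilityTheory.gaussianPDFReal, Complex.real_smul]
  push_cast
  simp
  ring

/-- The shifted Gaussian transform is asymptotic to `1 / x` at real infinity. -/
lemma tendsto_mul_shiftedGaussTransform {l : Filter ℝ} [l.IsCountablyGenerated]
    (hl : l ≤ Bornology.cobounded ℝ) :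
    Tendsto (fun x : ℝ => (x : ℂ) * shiftedGaussTransform (x : ℂ)) l (nhds 1) := by
  have hne : ∀ x y : ℝ, (x : ℂ) - y + I ≠ 0 := fun x y h => by
    simpa using congrArg Complex.im h
  have hnorm : ∀ x y : ℝ, 1 ≤ ‖(x : ℂ) - y + I‖ := fun x y => by
    simpa using Complex.abs_im_le_norm ((x : ℂ) - y + I)
  have hdecomp : ∀ x y : ℝ, (x : ℂ) / (x - y + I) = 1 + (y - I) * ((x : ℂ) - y + I)⁻¹ := by
    intro x y
    have := hne x y
    field_simp
    ring
  have hpoint : ∀ y : ℝ, Tendsto (fun x : ℝ => (x : ℂ) / (x - y + I)) l (nhds 1) := by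
    intro y
    simp_rw [hdecomp]
    have : Tendsto (fun x : ℝ => (x : ℂ) - y + I) l (Bornology.cobounded ℂ) := by
      rw [← tendsto_norm_atTop_iff_cobounded]
      refine tendsto_atTop_mono (f := fun x : ℝ => ‖x‖ - ‖(y : ℂ) - I‖) (fun x => ?_) ?_
      · have := norm_sub_norm_le (x : ℂ) (y - I)
        rwa [Complex.norm_real, ← sub_add] at this
      · exact tendsto_atTop_add_const_right _ _ (tendsto_norm_cobounded_atTop.mono_left hl)
    simpa using ((tendsto_inv₀_cobounded.comp this).const_mul ((y : ℂ) - I)).const_add 1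
  have hbound : ∀ x y : ℝ, ‖(x : ℂ) / (x - y + I)‖ ≤ 2 + |y| := by
    intro x y
    rw [hdecomp]
    have h₁ : ‖(y : ℂ) - I‖ ≤ |y| + 1 := by simpa using norm_sub_le (y : ℂ) I
    have h₂ : ‖((x : ℂ) - y + I)⁻¹‖ ≤ 1 := by
      rw [norm_inv]
      exact inv_le_one_of_one_le₀ (hnorm x y)
    calc _ ≤ ‖(1 : ℂ)‖ + ‖((y : ℂ) - I) * ((x : ℂ) - y + I)⁻¹‖ := norm_add_le _ _
      _ ≤ 1 + (|y| + 1) * 1 := by rw [norm_one, norm_mul]; gcongr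
      _ = 2 + |y| := by ring
  have hint : Integrable fun y : ℝ => (2 + |y|) * Real.exp ((1 - y ^ 2) / 2) := by
    have h₀ := (integrable_exp_neg_mul_sq (b := 1 / 2) (by norm_num)).const_mul 2
    have h₁ := (integrable_mul_exp_neg_mul_sq (b := 1 / 2) (by norm_num)).norm
    refine ((h₀.add h₁).const_mul (Real.exp (1 / 2))).congr (.of_forall fun y => ?_)
    have : Real.exp ((1 - y ^ 2) / 2) = Real.exp (1 / 2) * Real.exp (-(1 / 2) * y ^ 2) := by
      rw [← Real.exp_add]
      congr 1
      ring
    simp only [Pi.add_apply, norm_mul, Real.norm_eq_abs, Real.abs_exp, this]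
    ring
  have key : Tendsto (fun x : ℝ => ∫ y : ℝ, (x : ℂ) / (x - y + I) *
      Complex.exp (-((y : ℂ) - I) ^ 2 / 2)) l (nhds (∫ y : ℝ, Complex.exp (-((y : ℂ) - I) ^ 2 / 2))) := by
    refine tendsto_integral_filter_of_dominated_convergence _ (.of_forall fun x => ?_)
      (.of_forall fun x => .of_forall fun y => ?_) hint (.of_forall fun y => ?_)
    · exact (Continuous.mul (Continuous.div (by fun_prop) (by fun_prop) (hne x))
        (by fun_prop)).aestronglyMeasurable
    · rw [norm_mul, norm_exp_neg_sq_div_two]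
      refine mul_le_mul (hbound x y) (le_of_eq ?_) (Real.exp_nonneg _) (by positivity)
      simp
    · simpa using (hpoint y).mul_const (Complex.exp (-((y : ℂ) - I) ^ 2 / 2))
  have hpi : (Real.sqrt (2 * Real.pi) : ℂ) ≠ 0 := by
    rw [Complex.ofReal_ne_zero]
    positivity
  have := key.const_mul (1 / (Real.sqrt (2 * Real.pi) : ℂ))
  rw [integral_exp_neg_sub_I_sq_div_two, one_div_mul_cancel hpi] at this
  refine this.congr fun x => ?_
  rw [shiftedGaussTransform, mul_left_comm, ← integral_const_mul (x : ℂ)]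
  congr 2 with y
  ring

theorem stmt_19 :
    (∀ z : ℂ, 0 < z.im →
      shiftedGaussTransform z = cauchyT (ProbabilityTheory.gaussianReal 0 1) z) ∧
    Tendsto (fun x : ℝ => (x : ℂ) * shiftedGaussTransform (x : ℂ)) atTop (nhds 1) ∧
    Tendsto (fun x : ℝ => (x : ℂ) * shiftedGaussTransform (x : ℂ)) atBot (nhds 1) := by
  refine ⟨fun z hz => ?_, tendsto_mul_shiftedGaussTransform ?_,
    tendsto_mul_shiftedGaussTransform ?_⟩
  · rw [cauchyT_gaussianReal, shiftedGaussTransform, integral_gaussian_div_sub_I_eq hz]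
  · exact IsOrderBornology.atTop_le_cobounded
  · exact IsOrderBornology.atBot_le_cobounded
end
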